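/- There exist universal constants c' ≥ c > 0 with c' ≥ 1 such that: for any finite point set X = {x_1,...,x_m} ⊆ X of size m, any hypothesis class H ⊆ {-1,1}^X of VC-dimension d, any 0 < ε < 1, any 0 < α < 1/2 and any 0 < γ ≤ 1 satisfying γ² ≥ c·d/(α²·ε²·m), it holds that ln N_∞(X, Δ(H)_⌈γ⌉, α·γ) ≤ (c'·d/(α²·ε²·γ²)) · Ln^{1+ε}( 8·α·m·ε²·γ²/(c·d) ). -/

import Mathlib

open MeasureTheory
open scoped ENNReal

/-- The truncated natural logarithm `Ln(x) = ln(max(x, e))`. -/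
noncomputable def Ln (x : ℝ) : ℝ := Real.log (max x (Real.exp 1))

/-- `func(x) = Ln(x) · Ln(Ln(x))²`. -/
noncomputable def func (x : ℝ) : ℝ := Ln x * (Ln (Ln x)) ^ 2

/-- The set `Δ(H)` of voting classifiers over `H`: all finite convex combinations
`f = ∑ i, α i • h i` with `h i ∈ H`, `α i > 0` and `∑ i, α i = 1`. -/
def votingClassifiers {X : Type*} (H : Set (X → ℝ)) : Set (X → ℝ) :=
  {f | ∃ (n : ℕ) (a : Fin n → ℝ) (h : Fin n → (X → ℝ)),
    (∀ i, h i ∈ H) ∧ (∀ i, 0 < a i) ∧ (∑ i, a i) = 1 ∧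
    f = fun x => ∑ i, a i * h i x}

/-- `H` realizes all ±1 labelings on the finite point set `s`. -/
def ShattersPM {X : Type*} (H : Set (X → ℝ)) (s : Finset X) : Prop :=
  ∀ b : X → ℝ, (∀ x, b x = 1 ∨ b x = -1) → ∃ h ∈ H, ∀ x ∈ s, h x = b x

/-- `H` has VC-dimension exactly `d`: some set of `d` points is shattered and every
shattered set has at most `d` points. -/
def HasVCDim {X : Type*} (H : Set (X → ℝ)) (d : ℕ) : Prop :=
  (∃ s : Finset X, ShattersPM H s ∧ s.card = d) ∧
    ∀ s : Finset X, ShattersPM H s → s.card ≤ d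

/-- Clipping of `f` at level `γ`. -/
noncomputable def clip {X : Type*} (γ : ℝ) (f : X → ℝ) : X → ℝ :=
  fun x => if γ < f x then γ else if f x < -γ then -γ else f x

/-- The clipped class `F_⌈γ⌉`. -/
def clipClass {X : Type*} (F : Set (X → ℝ)) (γ : ℝ) : Set (X → ℝ) := clip γ '' F

/-- `N` is an `α`-cover of `F` in `ℓ_∞` on the point set `xs`. -/
def IsCoverOn {X : Type*} {m : ℕ} (xs : Fin m → X) (F : Set (X → ℝ)) (α : ℝ)
    (N : Finset (X → ℝ)) : Prop :=
  ∀ f ∈ F, ∃ f' ∈ N, ∀ i, |f (xs i) - f' (xs i)| ≤ α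

/-- The `ℓ_∞` covering number `N_∞(xs, F, α)` (as an extended nonneg. real, `⊤` if no
finite cover exists). -/
noncomputable def coveringNumber {X : Type*} {m : ℕ} (xs : Fin m → X) (F : Set (X → ℝ))
    (α : ℝ) : ℝ≥0∞ :=
  ⨅ (N : Finset (X → ℝ)) (_ : IsCoverOn xs F α N), (N.card : ℝ≥0∞)

/-- `F` β-shatters the points `x` with witness levels `r`. -/
def FatShattersWith {X : Type*} (F : Set (X → ℝ)) (β : ℝ) {n : ℕ}
    (x : Fin n → X) (r : Fin n → ℝ) : Prop :=
  ∀ b : Fin n → Bool, ∃ f ∈ F, ∀ i,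
    (b i = true → r i + β ≤ f (x i)) ∧ (b i = false → f (x i) ≤ r i - β)

/-- `F` β-shatters some set of `n` points. -/
def FatShatters {X : Type*} (F : Set (X → ℝ)) (β : ℝ) (n : ℕ) : Prop :=
  ∃ (x : Fin n → X) (r : Fin n → ℝ), FatShattersWith F β x r

/-- The fat-shattering dimension `fat_β(F)` as an extended natural number. -/
noncomputable def fatDim {X : Type*} (F : Set (X → ℝ)) (β : ℝ) : ℕ∞ :=
  ⨆ (n : ℕ) (_ : FatShatters F β n), (n : ℕ∞)

/-- The γ-margin loss `L_D^γ(f) = Pr_{(x,y)∼D}[y·f(x) ≤ γ]`. -/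
noncomputable def margLossD {X : Type*} [MeasurableSpace X] (μ : Measure (X × ℝ)) (γ : ℝ)
    (f : X → ℝ) : ℝ :=
  (μ {p | p.2 * f p.1 ≤ γ}).toReal

/-- The empirical γ-margin loss `L_S^γ(f)`: the fraction of examples in `S` with margin at
most `γ`. -/
noncomputable def margLossS {X : Type*} {m : ℕ} (S : Fin m → X × ℝ) (γ : ℝ) (f : X → ℝ) : ℝ :=
  (Nat.card {i : Fin m // (S i).2 * f (S i).1 ≤ γ} : ℝ) / m

/-- The empirical θ-margin loss of `f` on the subsequence of `Z` indexed by `s`. -/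
noncomputable def lossIdx {X : Type*} {k : ℕ} (Z : Fin k → X × ℝ) (s : Finset (Fin k))
    (θ : ℝ) (f : X → ℝ) : ℝ :=
  (Nat.card {i : Fin k // i ∈ s ∧ (Z i).2 * f (Z i).1 ≤ θ} : ℝ) / s.card

/-- `L_{D_{c*}}(f) = Pr_{x∼D}[c*(x)·f(x) ≤ 0]`. -/
noncomputable def errD {X : Type*} [MeasurableSpace X] (D : Measure X) (c : X → ℝ)
    (f : X → ℝ) : ℝ :=
  (D {x | c x * f x ≤ 0}).toReal

/-- `maj(f₁,f₂,f₃) = sign(sign f₁ + sign f₂ + sign f₃)`, with `sign 0 = 0`. -/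
noncomputable def majf {X : Type*} (f₁ f₂ f₃ : X → ℝ) : X → ℝ :=
  fun x => Real.sign (Real.sign (f₁ x) + Real.sign (f₂ x) + Real.sign (f₃ x))

open Finset in
lemma exists_packing {α : Type*} (G : Finset α) (far : α → α → Prop)
    (hs : ∀ a b, far a b → far b a) (hi : ∀ a, ¬ far a a) :
    ∃ A ⊆ G, (∀ a ∈ A, ∀ b ∈ A, a ≠ b → far a b) ∧ ∀ g ∈ G, ∃ a ∈ A, ¬ far g a := by
  classical
  obtain ⟨A, hA, hmax⟩ := Finset.exists_max_image
    (G.powerset.filter fun A => ∀ a ∈ A, ∀ b ∈ A, a ≠ b → far a b) Finset.card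
    ⟨∅, by simp⟩
  simp only [mem_filter, mem_powerset] at hA hmax
  refine ⟨A, hA.1, hA.2, fun g hg => ?_⟩
  by_contra! hcon
  have hgA : g ∉ A := fun h => hi g (hcon g h)
  have := hmax (insert g A) ⟨insert_subset hg hA.1, by
    intro a ha b hb hab
    rcases mem_insert.1 ha with h1 | h1 <;> rcases mem_insert.1 hb with h2 | h2
    · exact absurd (h1.trans h2.symm) hab
    · exact h1 ▸ hcon b h2
    · exact h2 ▸ hs _ _ (hcon a h1)
    · exact hA.2 a h1 b h2 hab⟩
  rw [card_insert_of_notMem hgA] at this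
  omega

open Finset in
lemma count_opt {ι κ : Type*} [Fintype ι] [DecidableEq ι] (K : Finset κ) (w : ℝ) (hw : 0 < w)
    (hwm : w ≤ Fintype.card ι) (hR : 1 ≤ K.card) :
    (((Fintype.piFinset fun _ : ι => insertNone K).filter fun p => ((univ.filter fun i => (p i).isSome).card : ℝ) ≤ w).card : ℝ) ≤
      Real.exp (w * Real.log (Real.exp 1 * Fintype.card ι * K.card / w)) := by
  classical
  set m : ℝ := (Fintype.card ι : ℝ) with hm
  set R : ℝ := (K.card : ℝ) with hRdef
  have hR1 : (1:ℝ) ≤ R := by rw [hRdef]; exact_mod_cast hR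
  have hm0 : 0 < m := lt_of_lt_of_le hw hwm
  set x : ℝ := w / (m * R) with hx
  have hx0 : 0 < x := by positivity
  have hx1 : x ≤ 1 := by
    rw [hx, div_le_one (by positivity)]; nlinarith
  set P := (Fintype.piFinset fun _ : ι => insertNone K).filter fun p => ((univ.filter fun i => (p i).isSome).card : ℝ) ≤ w
  have key : ∑ p ∈ Fintype.piFinset fun _ : ι => insertNone K, ∏ i, (if (p i).isSome then x else 1) = (1 + R * x) ^ (Fintype.card ι) := by
    have := (Finset.prod_univ_sum (fun _ : ι => insertNone K) (fun _ o => if o.isSome then x else 1)).symm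
    rw [this]
    simp [sum_insertNone, hRdef]
  have h1 : (P.card : ℝ) * x ^ w ≤ (1 + R * x) ^ (Fintype.card ι) := by
    rw [← key, ← nsmul_eq_mul, ← sum_const]
    refine le_trans (sum_le_sum (fun p hp => ?_)) (sum_le_sum_of_subset_of_nonneg (filter_subset _ _) ?_)
    · have hp' := (mem_filter.1 hp).2
      rw [prod_ite, prod_const, prod_const_one, mul_one, ← Real.rpow_natCast]
      exact Real.rpow_le_rpow_of_exponent_ge hx0 hx1 hp'
    · intros; exact prod_nonneg (fun i _ => by split_ifs <;> linarith)
  have h2 : (1 + R * x) ^ (Fintype.card ι) ≤ Real.exp w := by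
    have : R * x = w / m := by rw [hx]; field_simp
    rw [this]
    calc (1 + w / m) ^ (Fintype.card ι) ≤ (Real.exp (w/m)) ^ (Fintype.card ι) := by
          apply pow_le_pow_left₀ (by positivity)
          linarith [Real.add_one_le_exp (w/m)]
      _ = Real.exp w := by
          rw [← Real.exp_nat_mul, ← hm]; congr 1; field_simp
  have h3 : (P.card : ℝ) ≤ Real.exp w * x ^ (-w) := by
    rw [Real.rpow_neg hx0.le, ← div_eq_mul_inv, le_div_iff₀ (by positivity)]
    exact h1.trans h2
  refine h3.trans (le_of_eq ?_)
  rw [Real.rpow_def_of_pos hx0, ← Real.exp_add]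
  congr 1
  have : Real.exp 1 * m * R / w = Real.exp 1 * x⁻¹ := by rw [hx]; field_simp
  rw [this, Real.log_mul (by positivity) (by positivity), Real.log_exp, Real.log_inv]
  ring

/-- VC bound for set families. -/
def VCle {ι : Type*} [DecidableEq ι] (V : Finset (Finset ι)) (d : ℕ) : Prop :=
  ∀ s, V.Shatters s → s.card ≤ d

open Finset in
lemma VCle.pull {ι κ : Type*} [DecidableEq ι] [DecidableEq κ] [Fintype κ] {V : Finset (Finset ι)} {d : ℕ}
    (hV : VCle V d) (σ : κ → ι) : VCle (V.image fun U => univ.filter fun k => σ k ∈ U) d := by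
  intro s hs
  have hinj : Set.InjOn σ s := by
    intro i hi j hj hij
    by_contra hne
    obtain ⟨u, hu, hu'⟩ := hs (t := {i}) (by simpa using hi)
    obtain ⟨U, hU, rfl⟩ := mem_image.1 hu
    have h1 : i ∈ s ∩ univ.filter fun k => σ k ∈ U := by rw [hu']; simp
    have h2 : j ∉ s ∩ univ.filter fun k => σ k ∈ U := by rw [hu']; simpa using fun h => hne h.symm
    simp only [mem_inter, mem_filter, mem_univ, true_and] at h1 h2
    exact h2 ⟨hj, hij ▸ h1.2⟩
  rw [← card_image_of_injOn hinj]
  apply hV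
  intro t ht
  obtain ⟨u, hu, hu'⟩ := hs (t := s.filter fun k => σ k ∈ t) (filter_subset _ _)
  obtain ⟨U, hU, rfl⟩ := mem_image.1 hu
  refine ⟨U, hU, ?_⟩
  ext x
  simp only [mem_inter, mem_image]
  constructor
  · rintro ⟨⟨k, hk, rfl⟩, hx⟩
    have : k ∈ s.filter fun k => σ k ∈ t := by rw [← hu']; simp [hk, hx]
    exact (mem_filter.1 this).2
  · intro hx
    obtain ⟨k, hk, rfl⟩ := mem_image.1 (ht hx)
    refine ⟨⟨k, hk, rfl⟩, ?_⟩
    have : k ∈ s ∩ univ.filter fun k => σ k ∈ U := by rw [hu']; simp [hk, hx]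
    simpa using (mem_inter.1 this).2

open Finset in
lemma VCle.sauer {κ : Type*} [DecidableEq κ] [Fintype κ] {V : Finset (Finset κ)} {d : ℕ}
    (hV : VCle V d) (x : ℝ) (hx : 0 < x) (hx1 : x ≤ 1) :
    (V.card : ℝ) * x ^ d ≤ (1 + x) ^ (Fintype.card κ) := by
  have h1 : V.card ≤ ∑ k ∈ Iic d, (Fintype.card κ).choose k := by
    refine (V.card_le_card_shatterer).trans (card_shatterer_le_sum_vcDim.trans ?_)
    apply sum_le_sum_of_subset
    apply Iic_subset_Iic.2
    exact Finset.sup_le fun s hs => hV s (mem_shatterer.1 hs)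
  set n := Fintype.card κ
  calc (V.card : ℝ) * x ^ d ≤ (∑ k ∈ Iic d, (n.choose k : ℝ)) * x ^ d := by
        gcongr; exact_mod_cast h1
    _ = ∑ k ∈ Iic d, (n.choose k : ℝ) * x ^ d := by rw [sum_mul]
    _ ≤ ∑ k ∈ Iic d, (n.choose k : ℝ) * x ^ k := by
        apply sum_le_sum
        intro k hk
        gcongr ?_ * ?_
        exact pow_le_pow_of_le_one hx.le hx1 (mem_Iic.1 hk)
    _ ≤ ∑ k ∈ range (max d n + 1), (n.choose k : ℝ) * x ^ k := by
        apply sum_le_sum_of_subset_of_nonneg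
        · intro k; simp; omega
        · intros; positivity
    _ = ∑ k ∈ range (n + 1), (n.choose k : ℝ) * x ^ k := by
        symm
        apply sum_subset
        · intro k; simp; omega
        · intro k _ hk
          rw [Nat.choose_eq_zero_of_lt (by simpa using hk)]; simp
    _ = (1 + x) ^ n := by
        rw [add_comm (1:ℝ) x, add_pow]
        apply sum_congr rfl; intros; simp [mul_comm]
lemma VCle.mono {ι : Type*} [DecidableEq ι] {V W : Finset (Finset ι)} {d : ℕ} (hV : VCle V d) (h : W ⊆ V) :
    VCle W d := fun s hs => hV s (hs.mono_left h)

open Finset in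
lemma packing_bound {ι : Type*} [Fintype ι] [DecidableEq ι] (V : Finset (Finset ι)) (d : ℕ) (hd : 1 ≤ d)
    (hV : VCle V d) (τ : ℝ) (h0 : 0 < τ) (h1 : τ ≤ 1)
    (sep : ∀ U ∈ V, ∀ U' ∈ V, U ≠ U' → τ * Fintype.card ι ≤ ((symmDiff U U').card : ℝ)) :
    (V.card : ℝ) ≤ Real.exp (2 * d * Real.log (8 / τ)) := by
  have hlog : 1 ≤ Real.log (8 / τ) := by
    rw [Real.le_log_iff_exp_le (by positivity)]
    have : (8:ℝ) ≤ 8 / τ := by rw [le_div_iff₀ h0]; nlinarith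
    linarith [Real.exp_one_lt_d9]
  have hd' : (1:ℝ) ≤ d := by exact_mod_cast hd
  by_cases hN : V.card ≤ 1
  · calc (V.card : ℝ) ≤ 1 := by exact_mod_cast hN
      _ ≤ _ := Real.one_le_exp (by positivity)
  push Not at hN
  obtain ⟨U0, hU0, U1, hU1, hne⟩ := one_lt_card.1 hN
  set n := Fintype.card ι with hn
  have hn0 : 0 < n := by
    obtain ⟨x, hx⟩ := (Finset.symmDiff_nonempty.2 hne)
    exact Fintype.card_pos_iff.2 ⟨x⟩
  set N : ℝ := (V.card : ℝ) with hNd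
  have hN2 : (2:ℝ) ≤ N := by rw [hNd]; exact_mod_cast hN
  set k := ⌊2 * Real.log N / τ⌋₊ + 1 with hk
  have hlN : 0 ≤ Real.log N := Real.log_nonneg (by linarith)
  have hk1 : 2 * Real.log N < τ * k := by
    have := Nat.lt_floor_add_one (2 * Real.log N / τ)
    rw [div_lt_iff₀ h0] at this
    rw [hk]; push_cast; linarith
  have hk2 : τ * k ≤ 2 * Real.log N + τ := by
    have := Nat.floor_le (a := 2 * Real.log N / τ) (by positivity)
    rw [le_div_iff₀ h0] at this
    rw [hk]; push_cast; linarith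
  have hex : ∃ σ : Fin k → ι, ∀ U ∈ V, ∀ U' ∈ V, U ≠ U' → ∃ i, σ i ∈ symmDiff U U' := by
    by_contra! hcon
    have hsub : (univ : Finset (Fin k → ι)) ⊆ V.offDiag.biUnion
        (fun p => Fintype.piFinset fun _ : Fin k => (symmDiff p.1 p.2)ᶜ) := by
      intro σ _
      obtain ⟨U, hU, U', hU', hne, h⟩ := hcon σ
      simp only [mem_biUnion, Fintype.mem_piFinset, mem_compl]
      exact ⟨(U, U'), by simp [hU, hU', hne], h⟩
    have hc := (card_le_card hsub).trans card_biUnion_le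
    have hc' : (n : ℝ) ^ k ≤ ∑ p ∈ V.offDiag, (n : ℝ) ^ k * Real.exp (-(τ * k)) := by
      calc (n : ℝ) ^ k = ((univ : Finset (Fin k → ι)).card : ℝ) := by simp [hn]
        _ ≤ ∑ p ∈ V.offDiag, ((Fintype.piFinset fun _ : Fin k => (symmDiff p.1 p.2)ᶜ).card : ℝ) := by
            exact_mod_cast hc
        _ ≤ _ := by
            apply sum_le_sum
            intro p hp
            rw [mem_offDiag] at hp
            have hs := sep _ hp.1 _ hp.2.1 hp.2.2
            rw [Fintype.card_piFinset_const, card_compl, Nat.cast_pow,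
              Nat.cast_sub (card_le_univ _)]
            have e : -(τ * k) = (k:ℝ) * (-τ) := by ring
            rw [e, Real.exp_nat_mul, ← mul_pow]
            apply pow_le_pow_left₀
            · rw [sub_nonneg]; exact_mod_cast card_le_univ _
            · have := Real.add_one_le_exp (-τ)
              have hn0' : (0:ℝ) < n := by exact_mod_cast hn0
              nlinarith
    rw [sum_const, nsmul_eq_mul, offDiag_card] at hc'
    have hle : ((V.card * V.card - V.card : ℕ) : ℝ) ≤ N * N := by
      rw [hNd]; exact_mod_cast Nat.sub_le _ _
    have hnk : (0:ℝ) < (n:ℝ) ^ k := by positivity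
    have : N * N * Real.exp (-(τ * k)) < 1 := by
      have : N * N = Real.exp (2 * Real.log N) := by
        rw [two_mul, Real.exp_add, Real.exp_log (by linarith)]
      rw [this, ← Real.exp_add, Real.exp_lt_one_iff]
      linarith
    have h3 : (n:ℝ)^k ≤ (N * N) * ((n : ℝ) ^ k * Real.exp (-(τ * k))) :=
      hc'.trans (by gcongr)
    nlinarith
  obtain ⟨σ, hσ⟩ := hex
  have hcard : (V.image fun U => univ.filter fun k => σ k ∈ U).card = V.card := by
    apply card_image_of_injOn
    intro U hU U' hU' h
    by_contra hne
    obtain ⟨i, hi⟩ := hσ U hU U' hU' hne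
    have h' := congrArg (fun s => i ∈ s) h
    simp only [mem_filter, mem_univ, true_and, eq_iff_iff] at h'
    rw [mem_symmDiff] at hi
    tauto
  have hS := (hV.pull σ).sauer (τ / 8) (by positivity) (by linarith)
  rw [hcard, Fintype.card_fin] at hS
  have hS2 : N * (τ / 8) ^ d ≤ Real.exp (τ * k / 8) := by
    refine hS.trans ?_
    have e : τ * k / 8 = (k:ℝ) * (τ / 8) := by ring
    rw [e, Real.exp_nat_mul]
    apply pow_le_pow_left₀ (by positivity)
    linarith [Real.add_one_le_exp (τ / 8)]
  have hS3 := Real.log_le_log (by positivity) hS2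
  rw [Real.log_exp, Real.log_mul (by positivity) (by positivity), Real.log_pow] at hS3
  have e : Real.log (τ / 8) = - Real.log (8 / τ) := by rw [← Real.log_inv]; congr 1; field_simp
  rw [e] at hS3
  rw [← Real.log_le_iff_le_exp (by positivity)]
  nlinarith

open Finset in
/-- existence of good signs -/
lemma exists_signs {ι Q : Type*} [Fintype ι] (S : Finset Q) (a : Q → ι → ℝ) (lam T : Q → ℝ)
    (hl : ∀ q ∈ S, 0 < lam q)
    (h : ∑ q ∈ S, 2 * Real.exp (lam q ^ 2 * (∑ i, a q i ^ 2) / 2 - lam q * T q) < 1) :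
    ∃ b : ι → Bool, ∀ q ∈ S, |∑ i, (if b i then 1 else -1) * a q i| ≤ T q := by
  classical
  set sg : Bool → ℝ := fun b => if b then 1 else -1 with hsg
  have mgf : ∀ c : ι → ℝ, ∑ b : ι → Bool, Real.exp (∑ i, sg (b i) * c i) ≤
      2 ^ (Fintype.card ι) * Real.exp ((∑ i, c i ^ 2) / 2) := by
    intro c
    have e1 : ∑ b : ι → Bool, Real.exp (∑ i, sg (b i) * c i) = ∏ i, (2 * Real.cosh (c i)) := by
      simp_rw [Real.exp_sum]
      have := (Finset.prod_univ_sum (fun _ : ι => (univ : Finset Bool)) (fun i o => Real.exp (sg o * c i))).symm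
      rw [Fintype.piFinset_univ] at this
      rw [this]
      apply prod_congr rfl
      intro i _
      simp [hsg, Real.cosh_eq]; ring
    rw [e1, prod_mul_distrib, prod_const, card_univ]
    gcongr
    rw [sum_div, Real.exp_sum]
    apply prod_le_prod
    · intros; exact (Real.cosh_pos _).le
    · intros; exact Real.cosh_le_exp_half_sq _
  by_contra! hcon
  have hb : ∀ b : ι → Bool, (1:ℝ) ≤ ∑ q ∈ S,
      (Real.exp (∑ i, sg (b i) * (lam q * a q i)) + Real.exp (∑ i, sg (b i) * (-lam q * a q i)))
        * Real.exp (- (lam q * T q)) := by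
    intro b
    obtain ⟨q, hq, hlt⟩ := hcon b
    refine le_trans ?_ (single_le_sum (f := fun q => (Real.exp (∑ i, sg (b i) * (lam q * a q i)) + Real.exp (∑ i, sg (b i) * (-lam q * a q i)))
        * Real.exp (- (lam q * T q))) (fun q _ => by positivity) hq)
    have e1 : ∑ i, sg (b i) * (lam q * a q i) = lam q * ∑ i, sg (b i) * a q i := by
      rw [mul_sum]; apply sum_congr rfl; intros; ring
    have e2 : ∑ i, sg (b i) * (-lam q * a q i) = - (lam q * ∑ i, sg (b i) * a q i) := by
      rw [mul_sum, ← sum_neg_distrib]; apply sum_congr rfl; intros; ring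
    simp only [e1, e2]
    rw [add_mul, ← Real.exp_add, ← Real.exp_add]
    have hl := hl q hq
    change T q < |∑ i, sg (b i) * a q i| at hlt
    rcases lt_abs.1 hlt with h1 | h1
    · have : 1 ≤ Real.exp (lam q * ∑ i, sg (b i) * a q i + -(lam q * T q)) :=
        Real.one_le_exp (by nlinarith)
      linarith [Real.exp_pos (-(lam q * ∑ i, sg (b i) * a q i) + -(lam q * T q))]
    · have : 1 ≤ Real.exp (-(lam q * ∑ i, sg (b i) * a q i) + -(lam q * T q)) :=
        Real.one_le_exp (by nlinarith)
      linarith [Real.exp_pos ((lam q * ∑ i, sg (b i) * a q i) + -(lam q * T q))]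
  have hsum := sum_le_sum (s := univ) (fun b _ => hb b)
  rw [sum_comm] at hsum
  have hfin : ∑ q ∈ S, ∑ b : ι → Bool,
      (Real.exp (∑ i, sg (b i) * (lam q * a q i)) + Real.exp (∑ i, sg (b i) * (-lam q * a q i)))
        * Real.exp (- (lam q * T q)) ≤ ∑ q ∈ S, 2 ^ (Fintype.card ι) *
        (2 * Real.exp (lam q ^ 2 * (∑ i, a q i ^ 2) / 2 - lam q * T q)) := by
    apply sum_le_sum
    intro q _
    rw [← sum_mul, sum_add_distrib]
    have m1 := mgf (fun i => lam q * a q i)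
    have m2 := mgf (fun i => -lam q * a q i)
    have e1 : ∑ i, (lam q * a q i) ^ 2 = lam q ^ 2 * ∑ i, a q i ^ 2 := by
      rw [mul_sum]; apply sum_congr rfl; intros; ring
    have e2 : ∑ i, (-lam q * a q i) ^ 2 = lam q ^ 2 * ∑ i, a q i ^ 2 := by
      rw [mul_sum]; apply sum_congr rfl; intros; ring
    simp only [e1] at m1
    simp only [e2] at m2
    rw [sub_eq_add_neg, Real.exp_add]
    have := mul_le_mul_of_nonneg_right (add_le_add m1 m2) (Real.exp_pos (-(lam q * T q))).le
    linarith
  rw [← mul_sum] at hfin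
  have h2 : (0:ℝ) < 2 ^ (Fintype.card ι) := by positivity
  have h3 : ∑ b : ι → Bool, (1:ℝ) = 2 ^ (Fintype.card ι) := by simp
  nlinarith
open Finset in
lemma rademacher {ι : Type*} [Fintype ι] [DecidableEq ι] (V : Finset (Finset ι)) (d : ℕ) (hd : 1 ≤ d)
    (hV : VCle V d) : ∃ b : ι → Bool, ∀ U ∈ V, ∀ U' ∈ V,
      ∑ i, (if b i then (1:ℝ) else -1) * ((if i ∈ U then (1:ℝ) else 0) - (if i ∈ U' then (1:ℝ) else 0))
        ≤ 68 * Real.sqrt (d * Fintype.card ι) := by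
  have hd' : (1:ℝ) ≤ d := by exact_mod_cast hd
  rcases V.eq_empty_or_nonempty with rfl | ⟨U0, hU0⟩
  · exact ⟨fun _ => true, by simp⟩
  set n := Fintype.card ι with hn
  rcases Nat.eq_zero_or_pos n with hn0 | hn0
  · have : IsEmpty ι := Fintype.card_eq_zero_iff.1 hn0
    exact ⟨fun _ => true, fun U _ U' _ => by rw [univ_eq_empty, sum_empty]; positivity⟩
  have hn1 : (0:ℝ) < n := by exact_mod_cast hn0
  have hW : ∀ j : ℕ, ∃ W ⊆ V, (j = 0 → W = {U0}) ∧ (W.card : ℝ) ≤ Real.exp (8 * d * j) ∧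
      ∀ U ∈ V, ∃ U' ∈ W, ((symmDiff U U').card : ℝ) ≤ (1/4)^j * n := by
    intro j
    rcases Nat.eq_zero_or_pos j with rfl | hj
    · refine ⟨{U0}, by simpa using hU0, fun _ => rfl, by simp, fun U hU => ⟨U0, by simp, ?_⟩⟩
      simp only [pow_zero, one_mul]
      exact_mod_cast card_le_univ _
    · obtain ⟨W, hWV, hsep, hcov⟩ := exists_packing V
        (fun U U' => (1/4:ℝ)^j * n < ((symmDiff U U').card : ℝ))
        (fun a b h => by rwa [symmDiff_comm]) (fun a => by simp)
      refine ⟨W, hWV, fun h => by omega, ?_, fun U hU => ?_⟩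
      · have hp := packing_bound W d hd (hV.mono hWV) ((1/4:ℝ)^j) (by positivity)
          (pow_le_one₀ (by norm_num) (by norm_num)) (fun U hU U' hU' hne => (hsep U hU U' hU' hne).le)
        refine hp.trans (Real.exp_le_exp.2 ?_)
        have e : (8:ℝ) / (1/4)^j = 2 ^ (3 + 2 * j) := by
          rw [pow_add, pow_mul, one_div, inv_pow, div_inv_eq_mul]; norm_num
        rw [e, Real.log_pow]
        have hj' : (1:ℝ) ≤ j := by exact_mod_cast hj
        have hl := Real.log_two_lt_d9
        have hl0 := Real.log_two_gt_d9
        have : ((3 + 2 * j : ℕ):ℝ) * Real.log 2 ≤ 4 * j := by push_cast; nlinarith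
        nlinarith
      · obtain ⟨U', h1, h2⟩ := hcov U hU
        exact ⟨U', h1, not_lt.1 h2⟩
  choose W hWV hW0 hWc hWcov using hW
  set ind : Finset ι → ι → ℝ := fun U i => if i ∈ U then 1 else 0 with hind
  have hsq : ∀ U U' : Finset ι, ∑ i, (ind U i - ind U' i) ^ 2 = ((symmDiff U U').card : ℝ) := by
    intro U U'
    rw [card_eq_sum_ones, Nat.cast_sum, ← sum_filter_add_sum_filter_not univ (· ∈ symmDiff U U')]
    rw [sum_eq_zero (s := univ.filter fun x => ¬ _)]
    · rw [add_zero, filter_mem_eq_inter, univ_inter]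
      apply sum_congr rfl
      intro i hi
      rw [mem_symmDiff] at hi
      rcases hi with ⟨h1, h2⟩ | ⟨h1, h2⟩ <;> simp [hind, h1, h2]
    · intro i hi
      simp only [mem_filter, mem_univ, true_and, mem_symmDiff] at hi
      by_cases h1 : i ∈ U <;> by_cases h2 : i ∈ U' <;> simp_all
  set S : Finset (Σ _ : ℕ, Finset ι × Finset ι) := (range n).sigma fun j =>
    ((W (j+1)) ×ˢ (W j)).filter fun p => ((symmDiff p.1 p.2).card : ℝ) ≤ 8 * (1/4)^(j+1) * n with hS
  obtain ⟨b, hb⟩ := exists_signs S (fun q i => ind q.2.1 i - ind q.2.2 i)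
    (fun q => 2 * 2 ^ (q.1+1) * Real.sqrt (d / n))
    (fun q => 17 * ((q.1+1) * (1/2)^(q.1+1)) * Real.sqrt (d * n))
    (fun q _ => by positivity) (by
      rw [hS, sum_sigma]
      have hs : ∀ j ∈ range n, ∑ p ∈ ((W (j+1)) ×ˢ (W j)).filter (fun p => ((symmDiff p.1 p.2).card : ℝ) ≤ 8 * (1/4)^(j+1) * n),
          2 * Real.exp ((2 * 2 ^ (j+1) * Real.sqrt (d / n)) ^ 2 * (∑ i, (ind p.1 i - ind p.2 i) ^ 2) / 2
            - (2 * 2 ^ (j+1) * Real.sqrt (d / n)) * (17 * ((j+1) * (1/2)^(j+1)) * Real.sqrt (d * n))) ≤ 2 * (1/4)^(j+1) := by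
        intro j _
        have e1 : (2 * 2 ^ (j+1) * Real.sqrt (d / n)) * (17 * ((j+1) * (1/2)^(j+1)) * Real.sqrt (d * n)) = 34 * (j+1) * d := by
          have : Real.sqrt (d / n) * Real.sqrt (d * n) = d := by
            rw [← Real.sqrt_mul (by positivity)]
            have : (d / n * (d * n) : ℝ) = d ^ 2 := by field_simp
            rw [this, Real.sqrt_sq (by positivity)]
          have h2 : (2:ℝ) ^ (j+1) * (1/2)^(j+1) = 1 := by rw [← mul_pow]; norm_num
          calc _ = 34 * (j+1) * ((2:ℝ) ^ (j+1) * (1/2)^(j+1)) * (Real.sqrt (d / n) * Real.sqrt (d * n)) := by ring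
            _ = _ := by rw [this, h2]; ring
        calc _ ≤ ∑ p ∈ ((W (j+1)) ×ˢ (W j)).filter (fun p => ((symmDiff p.1 p.2).card : ℝ) ≤ 8 * (1/4)^(j+1) * n),
              2 * Real.exp (16 * d - 34 * (j+1) * d) := by
              apply sum_le_sum
              intro p hp
              have hp := (mem_filter.1 hp).2
              rw [e1, hsq]
              gcongr
              have e2 : (2 * 2 ^ (j+1) * Real.sqrt (d / n)) ^ 2 = 4 * 4 ^ (j+1) * (d / n) := by
                rw [mul_pow, mul_pow, Real.sq_sqrt (by positivity), ← pow_mul, mul_comm (j+1) 2, pow_mul]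
                norm_num
              rw [e2]
              have h4 : (4:ℝ) ^ (j+1) * (1/4)^(j+1) = 1 := by rw [← mul_pow]; norm_num
              calc 4 * 4 ^ (j+1) * (d / n) * ((symmDiff p.1 p.2).card : ℝ) / 2
                  ≤ 4 * 4 ^ (j+1) * (d / n) * (8 * (1/4)^(j+1) * n) / 2 := by gcongr
                _ = 16 * ((4:ℝ) ^ (j+1) * (1/4)^(j+1)) * d := by field_simp; ring
                _ = 16 * d := by rw [h4]; ring
          _ = ((((W (j+1)) ×ˢ (W j)).filter (fun p => ((symmDiff p.1 p.2).card : ℝ) ≤ 8 * (1/4)^(j+1) * n)).card : ℝ) * (2 * Real.exp (16 * d - 34 * (j+1) * d)) := by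
              rw [sum_const, nsmul_eq_mul]
          _ ≤ (Real.exp (8 * d * (j+1)) * Real.exp (8 * d * j)) * (2 * Real.exp (16 * d - 34 * (j+1) * d)) := by
              gcongr
              have h1 : ((((W (j+1)) ×ˢ (W j)).filter (fun p => ((symmDiff p.1 p.2).card : ℝ) ≤ 8 * (1/4)^(j+1) * n)).card : ℝ) ≤ (W (j+1)).card * (W j).card := by
                rw [← Nat.cast_mul, ← card_product]; exact_mod_cast card_filter_le _ _
              refine h1.trans ?_
              have h2 := hWc (j+1)
              have h3 := hWc j
              push_cast at h2
              gcongr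
          _ = 2 * Real.exp (8 * d * (j+1) + 8 * d * j + (16 * d - 34 * (j+1) * d)) := by
              rw [Real.exp_add, Real.exp_add]; ring
          _ ≤ 2 * Real.exp (((j+1 : ℕ):ℝ) * (-2)) := by
              gcongr
              push_cast
              have : (0:ℝ) ≤ j := by positivity
              nlinarith
          _ ≤ _ := by
              rw [Real.exp_nat_mul]
              gcongr
              have h2 : Real.exp (-2) = (Real.exp 1)⁻¹ * (Real.exp 1)⁻¹ := by
                rw [← Real.exp_neg, ← Real.exp_add]; norm_num
              have h3 : (Real.exp 1)⁻¹ ≤ 1/2 := by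
                rw [inv_le_comm₀ (by positivity) (by norm_num)]
                linarith [Real.exp_one_gt_d9]
              have h4 : 0 < (Real.exp 1)⁻¹ := by positivity
              rw [h2]; nlinarith
      refine lt_of_le_of_lt (sum_le_sum hs) ?_
      have : ∀ J : ℕ, ∑ j ∈ range J, 2 * (1/4:ℝ)^(j+1) = 2/3 * (1 - (1/4)^J) := by
        intro J
        induction J with
        | zero => simp
        | succ J ih => rw [sum_range_succ, ih]; ring
      rw [this]
      have : (0:ℝ) < (1/4)^n := by positivity
      linarith)
  refine ⟨b, ?_⟩
  set sg : ι → ℝ := fun i => if b i then 1 else -1 with hsg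
  set L : Finset ι → ℝ := fun U => ∑ i, sg i * ind U i with hL
  have main : ∀ U ∈ V, |L U - L U0| ≤ 34 * Real.sqrt (d * n) := by
    intro U hU
    choose π hπW hπ using fun j => hWcov j U hU
    have hlast : π n = U := by
      have h1 := hπ n
      have h2 : (1/4:ℝ)^n * n < 1 := by
        have : (n:ℝ) < 4 ^ n := by exact_mod_cast Nat.lt_pow_self (by norm_num)
        rw [one_div, inv_pow, inv_mul_lt_iff₀ (by positivity)]; linarith
      have h3 : (symmDiff U (π n)).card < 1 := by
        exact_mod_cast h1.trans_lt h2
      have h4 : symmDiff U (π n) = ∅ := card_eq_zero.1 (by omega)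
      exact (symmDiff_eq_bot.1 h4).symm
    have hstep : ∀ j ∈ range n, |L (π (j+1)) - L (π j)| ≤ 17 * ((j+1) * (1/2)^(j+1)) * Real.sqrt (d * n) := by
      intro j hj
      have := hb ⟨j, (π (j+1), π j)⟩ (by
        rw [hS]
        simp only [mem_sigma, mem_filter, mem_product]
        refine ⟨hj, ⟨hπW _, hπW _⟩, ?_⟩
        have t : (symmDiff (π (j+1)) (π j)) ⊆ symmDiff (π (j+1)) U ∪ symmDiff U (π j) := symmDiff_triangle _ _ _
        have t2 := (card_le_card t).trans (card_union_le _ _)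
        have t3 : ((symmDiff (π (j+1)) (π j)).card : ℝ) ≤ (symmDiff (π (j+1)) U).card + (symmDiff U (π j)).card := by
          exact_mod_cast t2
        have t4 := hπ (j+1)
        rw [symmDiff_comm] at t4
        have t5 := hπ j
        have t6 : (1/4:ℝ)^j = 4 * (1/4)^(j+1) := by rw [pow_succ]; ring
        have t7 : 0 < (1/4:ℝ)^(j+1) * n := by positivity
        rw [t6] at t5
        linarith)
      simp only [mul_sub, sum_sub_distrib] at this
      simpa [hL, hsg] using this
    have h0 : π 0 = U0 := by have := hπW 0; rw [hW0 0 rfl] at this; simpa using this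
    have hsum : ∀ J : ℕ, ∑ j ∈ range J, 17 * (((j:ℝ)+1) * (1/2)^(j+1)) * Real.sqrt (d * n) = 17 * (2 - (J+2) * (1/2)^J) * Real.sqrt (d * n) := by
      intro J
      induction J with
      | zero => simp
      | succ J ih => rw [sum_range_succ, ih]; push_cast; ring
    have htel := sum_range_sub (fun j => L (π j)) n
    have hbound : |L (π n) - L (π 0)| ≤ 34 * Real.sqrt (d * n) := by
      rw [← htel]
      refine (abs_sum_le_sum_abs _ _).trans ((sum_le_sum hstep).trans ?_)
      rw [hsum]
      have : (0:ℝ) ≤ (n+2) * (1/2)^n := by positivity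
      have := Real.sqrt_nonneg (d * n : ℝ)
      nlinarith
    rwa [hlast, h0] at hbound
  intro U hU U' hU'
  have h1 := abs_le.1 (main U hU)
  have h2 := abs_le.1 (main U' hU')
  have e : ∑ i, (if b i then (1:ℝ) else -1) * ((if i ∈ U then (1:ℝ) else 0) - (if i ∈ U' then (1:ℝ) else 0)) = L U - L U' := by
    rw [hL, ← sum_sub_distrib]
    apply sum_congr rfl; intros; simp only [hsg, hind]; ring
  rw [e]; linarith [h1.1, h1.2, h2.1, h2.2]
open Finset in
lemma split_half {ι : Type*} (A : Finset ι) (X : ι → ℤ) (M : ℤ) (K : ℕ) (lam δ : ℝ)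
    (hl0 : 0 < lam) (hl1 : lam ≤ 1) (hA : A.Nonempty)
    (h0 : 2 * (A.filter fun g => M + 1 ≤ X g).card ≤ A.card) (hδ0 : 0 < δ)
    (hδ : δ * A.card ≤ (A.filter fun g => M + 2 * K + 1 ≤ X g).card)
    (hlam : 1 / 2 < δ ^ (lam ^ K)) :
    ∃ a : ℤ, (A.filter fun g => X g ≤ a).Nonempty ∧ (A.filter fun g => a + 2 ≤ X g).Nonempty ∧
      (A.card : ℝ) ^ lam ≤ ((A.filter fun g => X g ≤ a).card : ℝ) ^ lam +
        ((A.filter fun g => a + 2 ≤ X g).card : ℝ) ^ lam := by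
  have hN : (0:ℝ) < A.card := by exact_mod_cast hA.card_pos
  set N : ℝ := (A.card : ℝ) with hNd
  set u : ℕ → ℝ := fun j => ((A.filter fun g => M + 2 * j + 1 ≤ X g).card : ℝ) / N with hu
  have huK : δ ≤ u K := by rw [hu]; simp only; rw [le_div_iff₀ hN]; exact hδ
  have hanti : ∀ j k : ℕ, j ≤ k → u k ≤ u j := by
    intro j k hjk
    simp only [hu]
    gcongr
  have hu0 : u 0 ≤ 1/2 := by
    simp only [hu]
    rw [div_le_iff₀ hN]
    have : (2:ℝ) * (A.filter fun g => M + 1 ≤ X g).card ≤ N := by rw [hNd]; exact_mod_cast h0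
    simp only [Nat.cast_zero, mul_zero, add_zero]
    linarith
  by_cases hex : ∃ j < K, u j ≤ u (j+1) ^ lam
  · obtain ⟨j, hj, hle⟩ := hex
    refine ⟨M + 2 * j, ?_⟩
    have hpos : 0 < u (j+1) := hδ0.trans_le (huK.trans (hanti _ _ hj))
    have huj : u j ≤ 1/2 := (hanti 0 j (Nat.zero_le _)).trans hu0
    have huj0 : 0 ≤ u j := by simp only [hu]; positivity
    have c1 : ((A.filter fun g => X g ≤ M + 2 * j).card : ℝ) = N * (1 - u j) := by
      have := card_filter_add_card_filter_not (s := A) (fun g => X g ≤ M + 2 * j)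
      have e : (A.filter fun g => ¬ X g ≤ M + 2 * j) = A.filter fun g => M + 2 * j + 1 ≤ X g := by
        apply filter_congr; intros; omega
      rw [e] at this
      have : ((A.filter fun g => X g ≤ M + 2 * j).card : ℝ) + (A.filter fun g => M + 2 * j + 1 ≤ X g).card = N := by
        rw [hNd]; exact_mod_cast this
      simp only [hu]
      field_simp
      linarith
    have c2 : N * u (j+1) ≤ ((A.filter fun g => M + 2 * j + 2 ≤ X g).card : ℝ) := by
      simp only [hu]
      rw [mul_div_cancel₀ _ hN.ne']
      have : (A.filter fun g => M + 2 * ((j + 1 : ℕ):ℤ) + 1 ≤ X g) ⊆ A.filter fun g => M + 2 * j + 2 ≤ X g := by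
        apply monotone_filter_right; intro g _ h; push_cast at h; omega
      exact_mod_cast card_le_card this
    refine ⟨?_, ?_, ?_⟩
    · rw [← card_pos]; 
      have : (0:ℝ) < ((A.filter fun g => X g ≤ M + 2 * j).card : ℝ) := by rw [c1]; apply mul_pos hN; linarith
      exact_mod_cast this
    · rw [← card_pos]; 
      have : (0:ℝ) < ((A.filter fun g => M + 2 * j + 2 ≤ X g).card : ℝ) := lt_of_lt_of_le (by positivity) c2
      exact_mod_cast this
    · rw [c1]
      have h2 : (N * u (j+1)) ^ lam ≤ ((A.filter fun g => M + 2 * j + 2 ≤ X g).card : ℝ) ^ lam := by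
        gcongr
      refine le_trans ?_ (add_le_add_right h2 _)
      rw [Real.mul_rpow hN.le (by linarith), Real.mul_rpow hN.le hpos.le, ← mul_add]
      have h3 : 1 - u j ≤ (1 - u j) ^ lam := by
        conv_lhs => rw [← Real.rpow_one (1 - u j)]
        apply Real.rpow_le_rpow_of_exponent_ge (by linarith) (by linarith) hl1
      have : (0:ℝ) < N ^ lam := by positivity
      nlinarith
  · exfalso
    push Not at hex
    have ind : ∀ j ≤ K, u j ^ (lam ^ j) ≤ 1/2 := by
      intro j
      induction j with
      | zero => intro _; simpa using hu0
      | succ j ih =>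
        intro hj
        have h1 := ih (by omega)
        have h2 := hex j (by omega)
        have hpos : 0 < u (j+1) := hδ0.trans_le (huK.trans (hanti _ _ hj))
        rw [pow_succ', Real.rpow_mul hpos.le]
        refine le_trans ?_ h1
        exact Real.rpow_le_rpow (by positivity) h2.le (by positivity)
    have := ind K le_rfl
    have : δ ^ (lam ^ K) ≤ u K ^ (lam ^ K) := Real.rpow_le_rpow hδ0.le huK (by positivity)
    linarith

open Finset in
lemma split_full {ι : Type*} (A : Finset ι) (X : ι → ℤ) (K : ℕ) (lam δ : ℝ)
    (hl0 : 0 < lam) (hl1 : lam ≤ 1) (hA : A.Nonempty) (hδ0 : 0 < δ)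
    (hδ : 4 * δ * A.card * A.card ≤ ((A ×ˢ A).filter fun p => 4 * K + 2 ≤ |X p.1 - X p.2|).card)
    (hlam : 1 / 2 < δ ^ (lam ^ K)) :
    ∃ a : ℤ, (A.filter fun g => X g ≤ a).Nonempty ∧ (A.filter fun g => a + 2 ≤ X g).Nonempty ∧
      (A.card : ℝ) ^ lam ≤ ((A.filter fun g => X g ≤ a).card : ℝ) ^ lam +
        ((A.filter fun g => a + 2 ≤ X g).card : ℝ) ^ lam := by
  classical
  have hN : 0 < A.card := hA.card_pos
  obtain ⟨gmax, hgmax, hmax⟩ := A.exists_max_image X hA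
  obtain ⟨gmin, hgmin, hmin⟩ := A.exists_min_image X hA
  obtain ⟨M, hM, hMub⟩ := Int.exists_greatest_of_bdd (P := fun M => A.card ≤ 2 * (A.filter fun g => M ≤ X g).card)
    ⟨X gmax, fun z hz => by
      by_contra! hlt
      have : A.filter (fun g => z ≤ X g) = ∅ := by
        apply filter_eq_empty_iff.2; intro g hg; have := hmax g hg; omega
      rw [this, card_empty] at hz; omega⟩
    ⟨X gmin, by rw [filter_true_of_mem (fun g hg => hmin g hg)]; omega⟩
  have hup : 2 * (A.filter fun g => M + 1 ≤ X g).card ≤ A.card := by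
    by_contra! h
    have := hMub (M+1) h.le
    omega
  have hdown : 2 * (A.filter fun g => -M + 1 ≤ - X g).card ≤ A.card := by
    have := card_filter_add_card_filter_not (s := A) (fun g => M ≤ X g)
    have e : (A.filter fun g => ¬ M ≤ X g) = A.filter fun g => -M + 1 ≤ - X g := by
      apply filter_congr; intros; omega
    rw [e] at this
    omega
  have hNr : (0:ℝ) < A.card := by exact_mod_cast hN
  set B1 := A.filter fun g => M + 2 * K + 1 ≤ X g with hB1
  set B2 := A.filter fun g => -M + 2 * K + 1 ≤ - X g with hB2
  have hsub : ((A ×ˢ A).filter fun p => 4 * K + 2 ≤ |X p.1 - X p.2|) ⊆ (B1 ∪ B2) ×ˢ A ∪ A ×ˢ (B1 ∪ B2) := by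
    rintro ⟨g, g'⟩ h
    simp only [mem_filter, mem_product, le_abs] at h
    simp only [mem_union, mem_product, hB1, hB2, mem_filter]
    obtain ⟨⟨h1, h2⟩, h3⟩ := h
    simp only [h1, h2, true_and, and_true]
    omega
  have hcard := (card_le_card hsub).trans (card_union_le _ _)
  rw [card_product, card_product] at hcard
  have hB : (((A ×ˢ A).filter fun p => 4 * K + 2 ≤ |X p.1 - X p.2|).card : ℝ) ≤
      2 * A.card * (B1.card + B2.card) := by
    have h1 := card_union_le B1 B2
    have : ((A ×ˢ A).filter fun p => 4 * K + 2 ≤ |X p.1 - X p.2|).card ≤ 2 * A.card * (B1.card + B2.card) := by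
      nlinarith
    exact_mod_cast this
  have hB' : 2 * δ * A.card ≤ B1.card + B2.card := by
    have := hδ.trans hB
    have h3 : 0 ≤ (2 * A.card : ℝ) * ((B1.card + B2.card) - 2 * δ * A.card) := by linarith
    have := nonneg_of_mul_nonneg_right h3 (by positivity)
    linarith
  rcases le_or_gt (δ * A.card) (B1.card : ℝ) with h | h
  · exact split_half A X M K lam δ hl0 hl1 hA hup hδ0 h hlam
  · obtain ⟨a, h1, h2, h3⟩ := split_half A (fun g => - X g) (-M) K lam δ hl0 hl1 hA hdown hδ0 (by linarith) hlam
    have e1 : (A.filter fun g => - X g ≤ a) = A.filter fun g => (-a - 2) + 2 ≤ X g := by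
      apply filter_congr; intros; omega
    have e2 : (A.filter fun g => a + 2 ≤ - X g) = A.filter fun g => X g ≤ -a - 2 := by
      apply filter_congr; intros; omega
    rw [e1] at h1 h3
    rw [e2] at h2 h3
    exact ⟨-a-2, h2, h1, by linarith⟩

/-- shattered partial level functions -/
def Sh {ι : Type*} (A : Finset (ι → ℤ)) (p : ι → Option ℤ) : Prop :=
  ∀ b : ι → Bool, ∃ g ∈ A, ∀ i r, p i = some r → (b i = true → r + 2 ≤ g i) ∧ (b i = false → g i ≤ r)

lemma Sh.mono {ι : Type*} {A B : Finset (ι → ℤ)} {p : ι → Option ℤ} (h : Sh A p) (hAB : A ⊆ B) : Sh B p :=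
  fun b => by obtain ⟨g, hg, h⟩ := h b; exact ⟨g, hAB hg, h⟩

open Finset Classical in
lemma tree {ι : Type*} [Fintype ι] [DecidableEq ι] (M : ℤ) (w : ℝ) (hw : 0 < w) (K : ℕ) (lam : ℝ)
    (hl0 : 0 < lam) (hl1 : lam ≤ 1) (hlam : 1 / 2 < (w / (8 * Fintype.card ι)) ^ (lam ^ K))
    (A : Finset (ι → ℤ)) (hr : ∀ g ∈ A, ∀ i, g i ∈ Icc (-M) M)
    (sep : ∀ g ∈ A, ∀ g' ∈ A, g ≠ g' → w ≤ ((univ.filter fun i => 4 * (K:ℤ) + 2 ≤ |g i - g' i|).card : ℝ)) :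
    (A.card : ℝ) ^ lam ≤ (((Fintype.piFinset fun _ : ι => insertNone (Icc (-M) M)).filter fun p => Sh A p).card : ℝ) := by
  induction hc : A.card using Nat.strong_induction_on generalizing A with
  | _ N ih =>
  subst hc
  by_cases hN : A.card ≤ 1
  · rcases Nat.eq_zero_or_pos A.card with h | h
    · rw [h]; simp [Real.zero_rpow hl0.ne']
    · have : A.card = 1 := by omega
      obtain ⟨g, rfl⟩ := card_eq_one.1 this
      simp only [card_singleton, Nat.cast_one, Real.one_rpow, Nat.one_le_cast]
      apply card_pos.2
      exact ⟨fun _ => none, by simp [Sh]⟩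
  push Not at hN
  have hA : A.Nonempty := card_pos.1 (by omega)
  obtain ⟨g0, hg0, g1, hg1, hne⟩ := one_lt_card.1 hN
  have hm : 0 < Fintype.card ι := by
    by_contra! h
    have : IsEmpty ι := Fintype.card_eq_zero_iff.1 (by omega)
    exact hne (Subsingleton.elim _ _)
  have hmr : (0:ℝ) < Fintype.card ι := by exact_mod_cast hm
  -- choose coordinate
  have hcoord : ∃ i : ι, 4 * (w / (8 * Fintype.card ι)) * A.card * A.card ≤
      ((A ×ˢ A).filter fun p => 4 * (K:ℤ) + 2 ≤ |p.1 i - p.2 i|).card := by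
    by_contra! hcon
    have hs : ∑ i : ι, (((A ×ˢ A).filter fun p => 4 * (K:ℤ) + 2 ≤ |p.1 i - p.2 i|).card : ℝ) <
        ∑ i : ι, 4 * (w / (8 * Fintype.card ι)) * A.card * A.card :=
      sum_lt_sum_of_nonempty (card_pos.1 (by simpa using hm)) (fun i _ => hcon i)
    rw [sum_const, card_univ, nsmul_eq_mul] at hs
    have e1 : ∑ i : ι, (((A ×ˢ A).filter fun p => 4 * (K:ℤ) + 2 ≤ |p.1 i - p.2 i|).card : ℝ)
        = ∑ p ∈ A ×ˢ A, ((univ.filter fun i => 4 * (K:ℤ) + 2 ≤ |p.1 i - p.2 i|).card : ℝ) := by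
      simp only [card_filter, Nat.cast_sum]
      exact sum_comm
    have e2 : ∑ p ∈ A.offDiag, w ≤ ∑ p ∈ A ×ˢ A, ((univ.filter fun i => 4 * (K:ℤ) + 2 ≤ |p.1 i - p.2 i|).card : ℝ) := by
      refine le_trans (sum_le_sum ?_) (sum_le_sum_of_subset_of_nonneg (s := A.offDiag) ?_ ?_)
      · intro p hp
        rw [mem_offDiag] at hp
        exact sep _ hp.1 _ hp.2.1 hp.2.2
      · intro p hp; rw [mem_offDiag] at hp; simp [hp.1, hp.2.1]
      · intros; positivity
    rw [sum_const, nsmul_eq_mul, offDiag_card, Nat.cast_sub (Nat.le_mul_self _)] at e2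
    have e3 : (Fintype.card ι : ℝ) * (4 * (w / (8 * Fintype.card ι)) * A.card * A.card) = w * A.card * A.card / 2 := by
      field_simp; ring
    rw [e3, e1] at hs
    push_cast at e2
    have h2 : (2:ℝ) ≤ A.card := by exact_mod_cast hN
    have h3 : 0 ≤ w * A.card * (A.card - 2) := mul_nonneg (by positivity) (by linarith)
    nlinarith
  obtain ⟨i, hi⟩ := hcoord
  obtain ⟨a, hn1, hn2, hsplit⟩ := split_full A (fun g => g i) K lam _ hl0 hl1 hA (by positivity) hi hlam
  set A1 := A.filter fun g => g i ≤ a with hA1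
  set A2 := A.filter fun g => a + 2 ≤ g i with hA2
  have hs1 : A1 ⊆ A := filter_subset _ _
  have hs2 : A2 ⊆ A := filter_subset _ _
  obtain ⟨f1, hf1⟩ := hn1
  obtain ⟨f2, hf2⟩ := hn2
  have hf1' := mem_filter.1 hf1
  have hf2' := mem_filter.1 hf2
  have hlt1 : A1.card < A.card := card_lt_card ⟨hs1, fun h => by
    have := (mem_filter.1 (h hf2'.1)).2; omega⟩
  have hlt2 : A2.card < A.card := card_lt_card ⟨hs2, fun h => by
    have := (mem_filter.1 (h hf1'.1)).2; omega⟩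
  have i1 := ih _ hlt1 A1 (fun g hg => hr g (hs1 hg)) (fun g hg g' hg' => sep g (hs1 hg) g' (hs1 hg')) rfl
  have i2 := ih _ hlt2 A2 (fun g hg => hr g (hs2 hg)) (fun g hg g' hg' => sep g (hs2 hg) g' (hs2 hg')) rfl
  set T := Fintype.piFinset fun _ : ι => insertNone (Icc (-M) M) with hT
  have ha : a ∈ Icc (-M) M := by
    have r1 := mem_Icc.1 (hr _ hf1'.1 i)
    have r2 := mem_Icc.1 (hr _ hf2'.1 i)
    rw [mem_Icc]; omega
  set S1 := T.filter fun p => Sh A1 p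
  set S2 := T.filter fun p => Sh A2 p
  have hnone : ∀ p, p ∈ S1 ∩ S2 → p i = none := by
    intro p hp
    simp only [S1, S2, mem_inter, mem_filter] at hp
    by_contra h
    obtain ⟨r, hr⟩ := Option.ne_none_iff_exists'.1 h
    obtain ⟨x, hx, hx'⟩ := hp.1.2 (fun _ => true)
    obtain ⟨y, hy, hy'⟩ := hp.2.2 (fun _ => false)
    have q1 := (hx' i r hr).1 rfl
    have q2 := (hy' i r hr).2 rfl
    have q3 := (mem_filter.1 hx).2
    have q4 := (mem_filter.1 hy).2
    omega
  have hcard : S1.card + S2.card ≤ (T.filter fun p => Sh A p).card := by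
    rw [← card_union_add_card_inter]
    have hinj : Set.InjOn (fun p : ι → Option ℤ => Function.update p i (some a)) (S1 ∩ S2 : Finset _) := by
      intro p hp q hq h
      funext j
      by_cases hj : j = i
      · subst hj; rw [hnone p hp, hnone q hq]
      · have := congrFun h j
        simpa [Function.update_of_ne hj] using this
    rw [← card_image_of_injOn hinj, ← card_union_of_disjoint]
    · apply card_le_card
      intro p hp
      rcases mem_union.1 hp with hp | hp
      · rcases mem_union.1 hp with hp | hp
        · have := mem_filter.1 hp
          exact mem_filter.2 ⟨this.1, this.2.mono hs1⟩
        · have := mem_filter.1 hp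
          exact mem_filter.2 ⟨this.1, this.2.mono hs2⟩
      · obtain ⟨q, hq, rfl⟩ := mem_image.1 hp
        have hq' := mem_inter.1 hq
        have q1 := mem_filter.1 hq'.1
        have q2 := mem_filter.1 hq'.2
        refine mem_filter.2 ⟨?_, ?_⟩
        · rw [hT, Fintype.mem_piFinset]
          intro j
          by_cases hj : j = i
          · subst hj; simpa [mem_insertNone] using ha
          · rw [Function.update_of_ne hj]; exact (Fintype.mem_piFinset.1 q1.1) j
        · intro b
          cases hb : b i
          · obtain ⟨g, hg, hg'⟩ := q1.2 b
            refine ⟨g, hs1 hg, fun j r hjr => ?_⟩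
            by_cases hj : j = i
            · subst hj
              simp only [Function.update_self, Option.some.injEq] at hjr
              subst hjr
              simp only [hb, Bool.false_eq_true, false_imp_iff, true_and, true_imp_iff]
              exact (mem_filter.1 hg).2
            · rw [Function.update_of_ne hj] at hjr; exact hg' j r hjr
          · obtain ⟨g, hg, hg'⟩ := q2.2 b
            refine ⟨g, hs2 hg, fun j r hjr => ?_⟩
            by_cases hj : j = i
            · subst hj
              simp only [Function.update_self, Option.some.injEq] at hjr
              subst hjr
              simp only [hb, Bool.true_eq_false, false_imp_iff, and_true, true_imp_iff]
              exact (mem_filter.1 hg).2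
            · rw [Function.update_of_ne hj] at hjr; exact hg' j r hjr
    · rw [disjoint_left]
      intro p hp hp2
      obtain ⟨q, hq, rfl⟩ := mem_image.1 hp2
      rcases mem_union.1 hp with hp | hp
      · obtain ⟨g, hg, hg'⟩ := (mem_filter.1 hp).2 (fun _ => true)
        have := (hg' i a (by simp)).1 rfl
        have := (mem_filter.1 hg).2
        omega
      · obtain ⟨g, hg, hg'⟩ := (mem_filter.1 hp).2 (fun _ => false)
        have := (hg' i a (by simp)).2 rfl
        have := (mem_filter.1 hg).2
        omega
  have hcard' : (S1.card : ℝ) + S2.card ≤ (T.filter fun p => Sh A p).card := by exact_mod_cast hcard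
  linarith
lemma vot_le {X ι : Type*} [Fintype ι] (xs : ι → X) (H : Set (X → ℝ)) (wt : ι → ℝ) (c : ℝ)
    (h : ∀ h ∈ H, ∑ i, wt i * h (xs i) ≤ c) (f : X → ℝ) (hf : f ∈ votingClassifiers H) :
    ∑ i, wt i * f (xs i) ≤ c := by
  obtain ⟨n, a, hh, hH, ha, hs, rfl⟩ := hf
  calc ∑ i, wt i * ∑ j, a j * hh j (xs i) = ∑ j, a j * ∑ i, wt i * hh j (xs i) := by
        simp only [Finset.mul_sum]
        rw [Finset.sum_comm]
        apply Finset.sum_congr rfl; intro j _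
        apply Finset.sum_congr rfl; intro i _
        ring
    _ ≤ ∑ j, a j * c := Finset.sum_le_sum fun j _ => mul_le_mul_of_nonneg_left (h _ (hH j)) (ha j).le
    _ = c := by rw [← Finset.sum_mul, hs, one_mul]

lemma clip_sub {X : Type*} (γ : ℝ) (hγ : 0 < γ) (f g : X → ℝ) (x : X) (η : ℝ) (hη : 0 < η)
    (h : η ≤ clip γ f x - clip γ g x) : η ≤ f x - g x := by
  unfold clip at h
  split_ifs at h <;> linarith

lemma clip_mem {X : Type*} (γ : ℝ) (hγ : 0 < γ) (f : X → ℝ) (x : X) :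
    -γ ≤ clip γ f x ∧ clip γ f x ≤ γ := by
  unfold clip
  split_ifs <;> constructor <;> linarith

open Finset Classical in
lemma fat_bound {X ι : Type*} [Fintype ι] (xs : ι → X) (H : Set (X → ℝ)) (d : ℕ) (hd : 1 ≤ d)
    (hH : ∀ h ∈ H, ∀ x, h x = 1 ∨ h x = -1) (hvc : ∀ s : Finset X, ShattersPM H s → s.card ≤ d)
    (η γ : ℝ) (hη : 0 < η) (hγ : 0 < γ) (A : Finset (ι → ℤ))
    (hA : ∀ g ∈ A, ∃ f ∈ votingClassifiers H, ∀ i, g i = ⌊clip γ f (xs i) / η⌋)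
    (p : ι → Option ℤ) (hp : Sh A p) :
    ((univ.filter fun i => (p i).isSome).card : ℝ) ≤ 136 ^ 2 * d / η ^ 2 := by
  set S := univ.filter fun i => (p i).isSome with hS
  set V : Finset (Finset S) := univ.filter (fun U => ∃ h ∈ H, ∀ i : S, i ∈ U ↔ h (xs i) = 1) with hV
  have hVC : VCle V d := by
    intro s hs
    have hinj : Set.InjOn (fun i : S => xs i) s := by
      intro i hi j hj hij
      by_contra hne
      obtain ⟨U, hU, hU'⟩ := hs (t := {i}) (by simpa using hi)
      obtain ⟨h, hh, hUh⟩ := (mem_filter.1 hU).2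
      have h1 : i ∈ s ∩ U := by rw [hU']; simp
      have h2 : j ∉ s ∩ U := by rw [hU']; simpa using fun h => hne h.symm
      rw [mem_inter, hUh] at h1 h2
      simp only at hij
      rw [hij] at h1
      exact h2 ⟨hj, h1.2⟩
    rw [← card_image_of_injOn hinj]
    apply hvc
    intro b hb
    obtain ⟨U, hU, hU'⟩ := hs (t := s.filter fun i => b (xs i) = 1) (filter_subset _ _)
    obtain ⟨h, hh, hUh⟩ := (mem_filter.1 hU).2
    refine ⟨h, hh, fun x hx => ?_⟩
    obtain ⟨i, hi, rfl⟩ := mem_image.1 hx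
    have e : i ∈ s ∩ U ↔ i ∈ (s.filter fun i : S => b (xs i) = 1) := by rw [hU']
    rw [mem_inter, hUh, mem_filter] at e
    have e' : h (xs i) = 1 ↔ b (xs i) = 1 := by tauto
    rcases hb (xs i) with h1 | h1
    · rw [h1]; exact e'.2 h1
    · rw [h1]
      rcases hH h hh (xs i) with h2 | h2
      · have := e'.1 h2; rw [h1] at this; norm_num at this
      · exact h2
  obtain ⟨b, hb⟩ := rademacher V d hd hVC
  rw [Fintype.card_coe] at hb
  set n := S.card with hn
  set sg : S → ℝ := fun i => if b i then 1 else -1 with hsg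
  set B := 136 * Real.sqrt (d * n) with hB
  have hpair : ∀ h ∈ H, ∀ h' ∈ H, ∑ i : S, sg i * h (xs i) ≤ ∑ i : S, sg i * h' (xs i) + B := by
    intro h hh h' hh'
    have := hb (univ.filter fun i => h (xs i) = 1) (by simp only [hV, mem_filter, mem_univ, true_and]; exact ⟨h, hh, by simp⟩)
      (univ.filter fun i => h' (xs i) = 1) (by simp only [hV, mem_filter, mem_univ, true_and]; exact ⟨h', hh', by simp⟩)
    have e : ∀ h ∈ H, ∀ i : S, h (xs i) = 2 * (if i ∈ (univ.filter fun i : S => h (xs i) = 1) then (1:ℝ) else 0) - 1 := by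
      intro h hh i
      simp only [mem_filter, mem_univ, true_and]
      rcases hH h hh (xs i) with h1 | h1 <;> rw [h1] <;> norm_num
    rw [← sub_le_iff_le_add', ← sum_sub_distrib]
    calc ∑ i : S, (sg i * h (xs i) - sg i * h' (xs i)) = 2 * ∑ i : S, (if b i then (1:ℝ) else -1) * ((if i ∈ (univ.filter fun i : S => h (xs i) = 1) then (1:ℝ) else 0) - (if i ∈ (univ.filter fun i : S => h' (xs i) = 1) then (1:ℝ) else 0)) := by
          rw [mul_sum]
          apply sum_congr rfl
          intro i _
          rw [e h hh i, e h' hh' i]; ring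
      _ ≤ B := by rw [hB]; linarith
  have hvot : ∀ f ∈ votingClassifiers H, ∀ f' ∈ votingClassifiers H,
      ∑ i : S, sg i * f (xs i) ≤ ∑ i : S, sg i * f' (xs i) + B := by
    intro f hf f' hf'
    apply vot_le (fun i : S => xs i) H sg _ _ f hf
    intro h hh
    have := vot_le (fun i : S => xs i) H (fun i => - sg i) (B - ∑ i : S, sg i * h (xs i)) (fun h' hh' => by
      have := hpair h hh h' hh'
      simp only [neg_mul, sum_neg_distrib]; linarith) f' hf'
    simp only [neg_mul, sum_neg_distrib] at this
    linarith
  obtain ⟨g1, hg1, hg1'⟩ := hp (fun i => if h : i ∈ S then b ⟨i, h⟩ else true)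
  obtain ⟨g2, hg2, hg2'⟩ := hp (fun i => if h : i ∈ S then !b ⟨i, h⟩ else true)
  obtain ⟨f1, hf1, hf1'⟩ := hA g1 hg1
  obtain ⟨f2, hf2, hf2'⟩ := hA g2 hg2
  have aux : ∀ (f f' : X → ℝ) (x : X) (r : ℤ), r + 2 ≤ ⌊clip γ f x / η⌋ → ⌊clip γ f' x / η⌋ ≤ r → η ≤ f x - f' x := by
    intro f f' x r h1 h2
    apply clip_sub γ hγ f f' x η hη
    have h1' := Int.le_floor.1 h1
    have h2' := Int.floor_lt.1 (Int.lt_add_one_iff.2 h2)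
    rw [le_div_iff₀ hη] at h1'
    rw [div_lt_iff₀ hη] at h2'
    push_cast at h1' h2'
    linarith
  have hpt : ∀ i : S, η ≤ sg i * f1 (xs i) - sg i * f2 (xs i) := by
    rintro ⟨i, hi⟩
    obtain ⟨r, hr⟩ := Option.isSome_iff_exists.1 (mem_filter.1 hi).2
    have q1 := hg1' i r hr
    have q2 := hg2' i r hr
    simp only [hi, dif_pos] at q1 q2
    rw [hf1'] at q1
    rw [hf2'] at q2
    cases hbi : b ⟨i, hi⟩
    · simp only [hbi] at q1 q2
      have := aux f2 f1 (xs i) r (q2.1 rfl) (q1.2 trivial)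
      simp only [hsg, hbi, Bool.false_eq_true, if_false]; linarith
    · simp only [hbi] at q1 q2
      have := aux f1 f2 (xs i) r (q1.1 trivial) (q2.2 rfl)
      simp only [hsg, hbi, if_true]; linarith
  have hsum : (n : ℝ) * η ≤ B := by
    have h1 := hvot f1 hf1 f2 hf2
    have h2 : ∑ i : S, η ≤ ∑ i : S, (sg i * f1 (xs i) - sg i * f2 (xs i)) := sum_le_sum fun i _ => hpt i
    rw [sum_const, card_univ, Fintype.card_coe, nsmul_eq_mul, sum_sub_distrib] at h2
    linarith
  rcases Nat.eq_zero_or_pos n with h0 | h0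
  · rw [h0]; simp; positivity
  have hn0 : (0:ℝ) < n := by exact_mod_cast h0
  have hsq : (n * η) ^ 2 ≤ B ^ 2 := pow_le_pow_left₀ (by positivity) hsum 2
  rw [hB, mul_pow, mul_pow, Real.sq_sqrt (by positivity)] at hsq
  rw [le_div_iff₀ (by positivity)]
  have h3 : 0 ≤ (n:ℝ) * (136 ^ 2 * d - n * η ^ 2) := by nlinarith
  have := nonneg_of_mul_nonneg_right h3 hn0
  linarith

open Finset Classical in
lemma core {X : Type*} {m : ℕ} (xs : Fin m → X) (H : Set (X → ℝ)) (d : ℕ) (hd : 1 ≤ d) (hm : 1 ≤ m)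
    (hH : ∀ h ∈ H, ∀ x, h x = 1 ∨ h x = -1) (hvc : ∀ s : Finset X, ShattersPM H s → s.card ≤ d)
    (α γ : ℝ) (hα : 0 < α) (hγ : 0 < γ) (K : ℕ) (w lam : ℝ) (hw0 : 0 < w) (hwm : w ≤ m)
    (hw : 136 ^ 2 * d * (4 * K + 2) ^ 2 / (α * γ) ^ 2 ≤ w)
    (hl0 : 0 < lam) (hl1 : lam ≤ 1) (hlam : 1 / 2 < (w / (8 * m)) ^ (lam ^ K)) :
    ∃ N : Finset (X → ℝ), IsCoverOn xs (clipClass (votingClassifiers H) γ) (α * γ) N ∧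
      (N.card : ℝ) ≤ Real.exp ((1 + 1 / lam) *
        (w * Real.log (Real.exp 1 * m * (2 * (4 * K + 2) / α + 3) / w))) := by
  set η : ℝ := α * γ / (4 * K + 2) with hη
  have hη0 : 0 < η := by positivity
  set M : ℤ := ⌈(4 * K + 2) / α⌉ with hM
  have hM0 : 0 ≤ M := Int.ceil_nonneg (by positivity)
  have hM1 : (4 * K + 2) / α ≤ M := Int.le_ceil _
  have hM2 : (M:ℝ) < (4 * K + 2) / α + 1 := Int.ceil_lt_add_one _
  have hγη : γ / η = (4 * K + 2) / α := by rw [hη]; field_simp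
  set fl : (X → ℝ) → Fin m → ℤ := fun f i => ⌊clip γ f (xs i) / η⌋ with hfl
  have hrange : ∀ f i, fl f i ∈ Icc (-M) M := by
    intro f i
    obtain ⟨h1, h2⟩ := clip_mem γ hγ f (xs i)
    have h1' : -γ / η ≤ clip γ f (xs i) / η := by gcongr
    have h2' : clip γ f (xs i) / η ≤ γ / η := by gcongr
    rw [neg_div, hγη] at h1'
    rw [hγη] at h2'
    rw [mem_Icc]
    constructor
    · apply Int.le_floor.2; push_cast; linarith
    · have := Int.floor_le (clip γ f (xs i) / η)
      have : ((⌊clip γ f (xs i) / η⌋ : ℤ) : ℝ) ≤ M := by linarith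
      exact_mod_cast this
  set G : Finset (Fin m → ℤ) := (Fintype.piFinset fun _ => Icc (-M) M).filter
    (fun g => ∃ f ∈ votingClassifiers H, ∀ i, g i = fl f i) with hG
  obtain ⟨A, hAG, hsep, hcov⟩ := exists_packing G
    (fun g g' => w < ((univ.filter fun i => 4 * (K:ℤ) + 2 ≤ |g i - g' i|).card : ℝ))
    (fun a b h => by simpa only [abs_sub_comm] using h)
    (fun a => by
      rw [not_lt]
      have : (univ.filter fun i => 4 * (K:ℤ) + 2 ≤ |a i - a i|) = ∅ := by
        apply filter_eq_empty_iff.2; intro i _; simp; omega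
      rw [this]; simpa using hw0.le)
  set P := (Fintype.piFinset fun _ : Fin m => insertNone (Icc (-M) M)).filter
    fun p => ((univ.filter fun i => (p i).isSome).card : ℝ) ≤ w with hP
  set E := Real.exp (w * Real.log (Real.exp 1 * m * (2 * (4 * K + 2) / α + 3) / w)) with hE
  have hIcc : ((Icc (-M) M).card : ℝ) = 2 * M + 1 := by
    rw [Int.card_Icc]
    have : (((M + 1 - -M).toNat : ℤ) : ℝ) = ((M + 1 - -M : ℤ) : ℝ) := by
      rw [Int.toNat_of_nonneg (by omega)]
    rw [Int.cast_natCast] at this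
    rw [this]; push_cast; ring
  have hM0r : (0:ℝ) ≤ M := by exact_mod_cast hM0
  have hm0 : (0:ℝ) < m := by exact_mod_cast hm
  have hPE : (P.card : ℝ) ≤ E := by
    have := count_opt (ι := Fin m) (Icc (-M) M) w hw0 (by simpa using hwm)
      (card_pos.2 ⟨0, by rw [mem_Icc]; omega⟩)
    rw [Fintype.card_fin, hIcc] at this
    refine le_trans ?_ (this.trans ?_)
    · rw [hP]
    · rw [hE]
      have hR : (2 * (M:ℝ) + 1) ≤ 2 * (4 * K + 2) / α + 3 := by
        have : 2 * (4 * K + 2) / α = 2 * ((4 * K + 2) / α) := by ring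
        rw [this]; linarith
      refine Real.exp_le_exp.2 (mul_le_mul_of_nonneg_left (Real.log_le_log (by positivity) ?_) hw0.le)
      exact div_le_div_of_nonneg_right (mul_le_mul_of_nonneg_left hR (by positivity)) hw0.le
  have htree := tree M w hw0 K lam hl0 hl1 (by simpa using hlam) A
    (fun g hg i => (Fintype.mem_piFinset.1 (mem_filter.1 (hAG hg)).1) i)
    (fun g hg g' hg' hne => (hsep g hg g' hg' hne).le)
  have hsub : ((Fintype.piFinset fun _ : Fin m => insertNone (Icc (-M) M)).filter fun p => Sh A p) ⊆ P := by
    intro p hp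
    have hp' := mem_filter.1 hp
    refine mem_filter.2 ⟨hp'.1, ?_⟩
    refine (fat_bound xs H d hd hH hvc η γ hη0 hγ A (fun g hg => (mem_filter.1 (hAG hg)).2) p hp'.2).trans ?_
    refine le_trans (le_of_eq ?_) hw
    rw [hη]; field_simp
  have hAE : (A.card : ℝ) ≤ E ^ (1 / lam) := by
    have h1 : (A.card : ℝ) ^ lam ≤ E := htree.trans (le_trans (by exact_mod_cast card_le_card hsub) hPE)
    calc (A.card : ℝ) = ((A.card : ℝ) ^ lam) ^ (1 / lam) := by
          rw [← Real.rpow_mul (by positivity), mul_one_div_cancel hl0.ne', Real.rpow_one]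
      _ ≤ _ := by gcongr
  set F : (Fin m → ℤ) × (Fin m → Option ℤ) → X → ℝ := fun q x =>
    if h : ∃ i, xs i = x then η * (((q.2 h.choose).getD (q.1 h.choose) : ℤ) : ℝ) else 0 with hF
  refine ⟨(A ×ˢ P).image F, ?_, ?_⟩
  · rintro _ ⟨f, hf, rfl⟩
    have hgG : fl f ∈ G := mem_filter.2 ⟨Fintype.mem_piFinset.2 (hrange f), f, hf, fun _ => rfl⟩
    obtain ⟨g', hg', hnear⟩ := hcov _ hgG
    rw [not_lt] at hnear
    set p : Fin m → Option ℤ := fun i => if 4 * (K:ℤ) + 2 ≤ |fl f i - g' i| then some (fl f i) else none with hp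
    have hpP : p ∈ P := by
      refine mem_filter.2 ⟨Fintype.mem_piFinset.2 fun i => ?_, ?_⟩
      · simp only [hp]
        split_ifs
        · rw [some_mem_insertNone]; exact hrange f i
        · exact none_mem_insertNone
      · refine le_trans (le_of_eq ?_) hnear
        congr 2
        apply filter_congr
        intro i _
        simp only [hp]
        split_ifs with h <;> simp [h]
    refine ⟨F (g', p), mem_image_of_mem _ (mem_product.2 ⟨hg', hpP⟩), fun i => ?_⟩
    have hex : ∃ j, xs j = xs i := ⟨i, rfl⟩
    have hFe : F (g', p) (xs i) = η * (((p hex.choose).getD (g' hex.choose) : ℤ) : ℝ) := by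
      simp only [hF]; rw [dif_pos hex]
    rw [hFe]
    set j := hex.choose
    have hj : xs j = xs i := hex.choose_spec
    rw [← hj]
    have hz : |(((p j).getD (g' j) : ℤ) : ℝ) - fl f j| ≤ 4 * K + 1 := by
      have : |(p j).getD (g' j) - fl f j| ≤ 4 * K + 1 := by
        simp only [hp]
        split_ifs with h
        · simp; omega
        · simp only [Option.getD_none]; rw [abs_sub_comm]; omega
      exact_mod_cast this
    have f1 := Int.floor_le (clip γ f (xs j) / η)
    have f2 := Int.lt_floor_add_one (clip γ f (xs j) / η)
    rw [le_div_iff₀ hη0] at f1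
    rw [div_lt_iff₀ hη0] at f2
    have hηe : α * γ = η * (4 * K + 2) := by rw [hη]; field_simp
    rw [hηe]
    change ((fl f j : ℤ) : ℝ) * η ≤ _ at f1
    change _ < (((fl f j : ℤ) : ℝ) + 1) * η at f2
    obtain ⟨z1, z2⟩ := abs_le.1 hz
    rw [abs_le]
    constructor <;> nlinarith
  · calc (((A ×ˢ P).image F).card : ℝ) ≤ (A.card : ℝ) * P.card := by
          rw [← Nat.cast_mul, ← card_product]; exact_mod_cast card_image_le
      _ ≤ E ^ (1 / lam) * E := by gcongr
      _ = _ := by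
          rw [hE, ← Real.exp_mul, ← Real.exp_add]; congr 1; ring
lemma kchoice (ε L : ℝ) (h0 : 0 < ε) (h1 : ε < 1) (hL : 2 ≤ L) :
    ∃ K : ℕ, 1 ≤ K ∧ (K:ℝ) ≤ 2 / ε ∧ (K:ℝ) ≤ L ∧ L ^ (1 / (K:ℝ)) ≤ Real.exp 1 * L ^ ε := by
  have hlog : 0 < Real.log L := Real.log_pos (by linarith)
  have hlogL : Real.log L + 1 ≤ L := by linarith [Real.log_le_sub_one_of_pos (show 0 < L by linarith)]
  have hε : 1 < 1 / ε := by rw [lt_div_iff₀ h0]; linarith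
  have h2ε : 1 / ε + 1 ≤ 2 / ε := by
    have : 2 / ε = 1 / ε + 1 / ε := by ring
    linarith
  have hLε : 1 ≤ L ^ ε := Real.one_le_rpow (by linarith) h0.le
  have he : 1 ≤ Real.exp 1 := Real.one_le_exp (by norm_num)
  rcases le_total (1 / ε) (Real.log L) with h | h
  · refine ⟨⌈1/ε⌉₊, Nat.ceil_pos.2 (by positivity), ?_, ?_, ?_⟩
    · linarith [Nat.ceil_lt_add_one (a := 1/ε) (by positivity)]
    · linarith [Nat.ceil_lt_add_one (a := 1/ε) (by positivity)]
    · have h3 : 1 / ((⌈1/ε⌉₊ : ℕ) : ℝ) ≤ ε := by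
        have := Nat.le_ceil (1/ε)
        rw [div_le_iff₀ (by linarith)]
        rw [div_le_iff₀ h0] at this
        linarith
      have : L ^ (1 / ((⌈1/ε⌉₊ : ℕ) : ℝ)) ≤ L ^ ε := Real.rpow_le_rpow_of_exponent_le (by linarith) h3
      nlinarith
  · refine ⟨⌈Real.log L⌉₊, Nat.ceil_pos.2 hlog, ?_, ?_, ?_⟩
    · linarith [Nat.ceil_lt_add_one hlog.le]
    · linarith [Nat.ceil_lt_add_one hlog.le]
    · have h4 := Nat.le_ceil (Real.log L)
      have h5 : (0:ℝ) < ((⌈Real.log L⌉₊ : ℕ) : ℝ) := by linarith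
      rw [Real.rpow_def_of_pos (by linarith)]
      have : Real.exp (Real.log L * (1 / ((⌈Real.log L⌉₊ : ℕ) : ℝ))) ≤ Real.exp 1 := by
        apply Real.exp_le_exp.2
        rw [mul_one_div, div_le_one h5]; exact h4
      nlinarith

lemma cov_le {X : Type*} {m : ℕ} (xs : Fin m → X) (F : Set (X → ℝ)) (a B : ℝ) (N : Finset (X → ℝ))
    (h : IsCoverOn xs F a N) (hB : (N.card : ℝ) ≤ B) : coveringNumber xs F a ≤ ENNReal.ofReal B := by
  unfold coveringNumber
  refine (iInf₂_le N h).trans ?_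
  rw [← ENNReal.ofReal_natCast]
  exact ENNReal.ofReal_le_ofReal hB

lemma Ln_pos (x : ℝ) : 0 < Ln x := by
  unfold Ln
  have : 1 ≤ Real.log (max x (Real.exp 1)) := by
    rw [Real.le_log_iff_exp_le (by positivity)]; exact le_max_right _ _
  linarith

set_option maxHeartbeats 4000000 in
lemma main_case {X : Type*} {m : ℕ} (xs : Fin m → X) (H : Set (X → ℝ)) (d : ℕ) (hd : 1 ≤ d) (hm : 1 ≤ m)
    (hH : ∀ h ∈ H, ∀ x, h x = 1 ∨ h x = -1) (hvc : ∀ s : Finset X, ShattersPM H s → s.card ≤ d)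
    (ε α γ : ℝ) (he0 : 0 < ε) (he1 : ε < 1) (hα : 0 < α) (hα1 : α < 1 / 2) (hγ : 0 < γ)
    (c : ℝ) (hc : c = 136 ^ 2 * 144) (hyp : γ ^ 2 ≥ c * d / (α ^ 2 * ε ^ 2 * m)) :
    coveringNumber xs (clipClass (votingClassifiers H) γ) (α * γ) ≤
            ENNReal.ofReal (Real.exp ((100 * c * d / (α ^ 2 * ε ^ 2 * γ ^ 2)) *
              (Ln (8 * α * m * ε ^ 2 * γ ^ 2 / (c * d))) ^ ((1 : ℝ) + ε))) := by
  have hd' : (1:ℝ) ≤ d := by exact_mod_cast hd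
  have hm' : (1:ℝ) ≤ m := by exact_mod_cast hm
  have hc0 : 0 < c := by rw [hc]; norm_num
  set w : ℝ := c * d / (α ^ 2 * ε ^ 2 * γ ^ 2) with hw
  have hw0 : 0 < w := by positivity
  have hwm : w ≤ m := by
    rw [ge_iff_le, div_le_iff₀ (by positivity)] at hyp
    rw [hw, div_le_iff₀ (by positivity)]
    linarith
  set A0 : ℝ := 8 * α * m * ε ^ 2 * γ ^ 2 / (c * d) with hA0
  have hA0e : A0 = 8 * (m / w) / α := by
    rw [hA0, hw]; field_simp
  have hmw : 1 ≤ m / w := by rw [le_div_iff₀ hw0]; linarith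
  have hA16 : 16 ≤ A0 := by
    rw [hA0e, le_div_iff₀ hα]; nlinarith
  have hLn : Ln A0 = Real.log A0 := by
    unfold Ln; rw [max_eq_left]; linarith [Real.exp_one_lt_d9]
  rw [hLn]
  set L := Real.log A0 with hL
  have hlog16 : Real.log 16 ≤ L := Real.log_le_log (by norm_num) hA16
  have h16 : Real.log 16 = 4 * Real.log 2 := by
    rw [show (16:ℝ) = 2 ^ 4 by norm_num, Real.log_pow]; norm_num
  have hl2 := Real.log_two_gt_d9
  have hl2' := Real.log_two_lt_d9
  have hL2 : 2 ≤ L := by rw [h16] at hlog16; linarith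
  obtain ⟨K, hK1, hKε, hKL, hKp⟩ := kchoice ε L he0 he1 hL2
  have hK1' : (1:ℝ) ≤ K := by exact_mod_cast hK1
  set lam : ℝ := (Real.log 2 / L) ^ (1 / (K:ℝ)) with hlam
  have hq0 : 0 < Real.log 2 / L := by positivity
  have hq1 : Real.log 2 / L ≤ 1 := by rw [div_le_one (by linarith)]; linarith
  have hl0 : 0 < lam := by positivity
  have hl1 : lam ≤ 1 := Real.rpow_le_one hq0.le hq1 (by positivity)
  have hlK : lam ^ K = Real.log 2 / L := by
    rw [hlam, ← Real.rpow_natCast, ← Real.rpow_mul hq0.le, one_div_mul_cancel (by positivity), Real.rpow_one]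
  have hcond : 1 / 2 < (w / (8 * m)) ^ (lam ^ K) := by
    rw [hlK, Real.rpow_def_of_pos (by positivity)]
    have e1 : (1/2 : ℝ) = Real.exp (- Real.log 2) := by rw [Real.exp_neg, Real.exp_log (by norm_num)]; norm_num
    rw [e1, Real.exp_lt_exp]
    have e2 : Real.log (w / (8 * m)) = - Real.log (8 * (m / w)) := by
      rw [← Real.log_inv]; congr 1; field_simp
    have e3 : Real.log (8 * (m / w)) < L := by
      apply Real.log_lt_log (by positivity)
      rw [hA0e, lt_div_iff₀ hα]
      nlinarith
    rw [e2, neg_mul, neg_lt_neg_iff, ← mul_div_assoc, div_lt_iff₀ (by linarith)]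
    nlinarith
  have hwK : 136 ^ 2 * d * (4 * K + 2) ^ 2 / (α * γ) ^ 2 ≤ w := by
    have h1 : (4 * K + 2 : ℝ) ≤ 12 / ε := by
      have : 12 / ε = 6 * (2 / ε) := by ring
      linarith
    calc 136 ^ 2 * d * (4 * K + 2) ^ 2 / (α * γ) ^ 2 ≤ 136 ^ 2 * d * (12 / ε) ^ 2 / (α * γ) ^ 2 := by gcongr
      _ = w := by rw [hw, hc]; field_simp; ring
  obtain ⟨N, hN, hNc⟩ := core xs H d hd hm hH hvc α γ hα hγ K w lam hw0 hwm hwK hl0 hl1 hcond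
  refine cov_le _ _ _ _ N hN (hNc.trans (Real.exp_le_exp.2 ?_))
  have hlogb : Real.log (Real.exp 1 * m * (2 * (4 * K + 2) / α + 3) / w) ≤ 3 * L := by
    have hle : Real.exp 1 * m * (2 * (4 * K + 2) / α + 3) / w ≤ 16 * K * A0 := by
      have h1 : 2 * (4 * K + 2) / α + 3 ≤ 15 * K / α := by
        rw [div_add' _ _ _ hα.ne']
        gcongr
        nlinarith
      calc Real.exp 1 * m * (2 * (4 * K + 2) / α + 3) / w = Real.exp 1 * (m / w) * (2 * (4 * K + 2) / α + 3) := by ring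
        _ ≤ 3 * (m / w) * (15 * K / α) := by
            apply mul_le_mul _ h1 (by positivity) (by positivity)
            apply mul_le_mul_of_nonneg_right _ (by positivity)
            linarith [Real.exp_one_lt_d9]
        _ ≤ 16 * K * (8 * (m / w) / α) := by
            have : 0 < (K:ℝ) * (m / w) / α := by positivity
            have e1 : 3 * (m / w) * (15 * K / α) = 45 * ((K:ℝ) * (m / w) / α) := by ring
            have e2 : 16 * K * (8 * (m / w) / α) = 128 * ((K:ℝ) * (m / w) / α) := by ring
            rw [e1, e2]; linarith
        _ = _ := by rw [hA0e]
    refine (Real.log_le_log (by positivity) hle).trans ?_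
    rw [Real.log_mul (by positivity) (by positivity), Real.log_mul (by norm_num) (by positivity)]
    have : Real.log K ≤ K - 1 := Real.log_le_sub_one_of_pos (by positivity)
    linarith
  have hLε : 1 ≤ L ^ ε := Real.one_le_rpow (by linarith) he0.le
  have hinv : 1 / lam ≤ 6 * L ^ ε := by
    have e1 : 1 / lam = (L / Real.log 2) ^ (1 / (K:ℝ)) := by
      rw [hlam, one_div, ← Real.inv_rpow hq0.le, inv_div]
    have e2 : (L / Real.log 2) ^ (1 / (K:ℝ)) ≤ (2 * L) ^ (1 / (K:ℝ)) := by
      apply Real.rpow_le_rpow (by positivity) _ (by positivity)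
      rw [div_le_iff₀ (by linarith)]; nlinarith
    have e3 : (2:ℝ) ^ (1 / (K:ℝ)) ≤ 2 := by
      conv_rhs => rw [← Real.rpow_one 2]
      apply Real.rpow_le_rpow_of_exponent_le (by norm_num)
      rw [div_le_one (by positivity)]; exact hK1'
    rw [e1]
    refine e2.trans ?_
    rw [Real.mul_rpow (by norm_num) (by linarith)]
    calc (2:ℝ) ^ (1 / (K:ℝ)) * L ^ (1 / (K:ℝ)) ≤ 2 * (Real.exp 1 * L ^ ε) := by
          apply mul_le_mul e3 hKp (by positivity) (by norm_num)
      _ ≤ 6 * L ^ ε := by nlinarith [Real.exp_one_lt_d9]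
  have hpow : L ^ (1 + ε) = L * L ^ ε := by
    rw [Real.rpow_add (by linarith), Real.rpow_one]
  rw [hpow]
  have e : 100 * c * d / (α ^ 2 * ε ^ 2 * γ ^ 2) = 100 * w := by rw [hw]; ring
  rw [e]
  calc (1 + 1 / lam) * (w * Real.log (Real.exp 1 * m * (2 * (4 * K + 2) / α + 3) / w))
      ≤ (1 + 1 / lam) * (w * (3 * L)) := by gcongr
    _ ≤ (7 * L ^ ε) * (w * (3 * L)) := by gcongr; linarith
    _ ≤ 100 * w * (L * L ^ ε) := by
        have : 0 < w * L * L ^ ε := by positivity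
        nlinarith

/-- Lemma `coverfinal`. -/
theorem stmt_2 :
    ∃ c c' : ℝ, 0 < c ∧ c ≤ c' ∧ 1 ≤ c' ∧
      ∀ (X : Type) (m : ℕ) (xs : Fin m → X) (H : Set (X → ℝ)) (d : ℕ),
        (∀ h ∈ H, ∀ x, h x = 1 ∨ h x = -1) →
        HasVCDim H d →
        ∀ (ε α γ : ℝ), 0 < ε → ε < 1 → 0 < α → α < 1 / 2 → 0 < γ → γ ≤ 1 →
          γ ^ 2 ≥ c * d / (α ^ 2 * ε ^ 2 * m) →
          coveringNumber xs (clipClass (votingClassifiers H) γ) (α * γ) ≤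
            ENNReal.ofReal (Real.exp ((c' * d / (α ^ 2 * ε ^ 2 * γ ^ 2)) *
              (Ln (8 * α * m * ε ^ 2 * γ ^ 2 / (c * d))) ^ ((1 : ℝ) + ε))) := by
  refine ⟨136 ^ 2 * 144, 100 * (136 ^ 2 * 144), by norm_num, by norm_num, by norm_num, ?_⟩
  intro X m xs H d hH hvc ε α γ he0 he1 hα hα1 hγ hγ1 hyp
  have hLp : ∀ x : ℝ, 0 ≤ (Ln x) ^ ((1:ℝ) + ε) := fun x => Real.rpow_nonneg (Ln_pos x).le _
  rcases Nat.eq_zero_or_pos m with rfl | hm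
  · refine cov_le _ _ _ _ {fun _ => 0} (fun f _ => ⟨_, Finset.mem_singleton_self _, fun i => i.elim0⟩) ?_
    rw [Finset.card_singleton, Nat.cast_one]
    exact Real.one_le_exp (mul_nonneg (by positivity) (hLp _))
  rcases Nat.eq_zero_or_pos d with rfl | hd
  · obtain ⟨⟨s, hs, -⟩, hmax⟩ := hvc
    obtain ⟨h0, hh0, -⟩ := hs (fun _ => 1) (fun _ => Or.inl rfl)
    have huniq : ∀ h ∈ H, h = h0 := by
      intro h hh
      by_contra hne
      obtain ⟨x, hx⟩ := Function.ne_iff.1 hne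
      have := hmax {x} (by
        intro b hb
        simp only [Finset.mem_singleton, forall_eq]
        rcases hb x with h1 | h1 <;> rcases hH h hh x with h2 | h2 <;> rcases hH h0 hh0 x with h3 | h3
        all_goals first
          | exact absurd (h2.trans h3.symm) hx
          | exact ⟨h, hh, h2.trans h1.symm⟩
          | exact ⟨h0, hh0, h3.trans h1.symm⟩)
      simp at this
    refine cov_le _ _ _ _ {clip γ h0} ?_ ?_
    · rintro _ ⟨f, ⟨n, a, h, hhH, ha, hsum, rfl⟩, rfl⟩
      refine ⟨_, Finset.mem_singleton_self _, fun i => ?_⟩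
      have : (fun x => ∑ i, a i * h i x) = h0 := by
        funext x
        simp only [huniq _ (hhH _)]
        rw [← Finset.sum_mul, hsum, one_mul]
      rw [this, sub_self, abs_zero]; positivity
    · rw [Finset.card_singleton, Nat.cast_one]
      exact Real.one_le_exp (mul_nonneg (by positivity) (hLp _))
  exact main_case xs H d hd hm hH hvc.2 ε α γ he0 he1 hα hα1 hγ _ rfl hyp
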